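/- Fix γ > 0 and t > 0, and let ρ be a 2×2 Hermitian complex matrix with Tr ρ = 1. Define D(s) = [[1, e^{−γs}],[e^{−γs}, 1]], m₁(0) = Tr{σ₁ (D(0) ∘ ρ)}, m₂(0) = Tr{Q₂ (D(0) ∘ ρ)} and m₂(t) = Tr{Q₂ (D(t) ∘ ρ)}, where Q₂ = σ₂ + σ₃ and ∘ is the Hadamard product. Then ρ = (1/2)( I₂ + m₁(0) σ₁ + ((m₂(t) − m₂(0))/(e^{−γt} − 1)) σ₂ + ((m₂(0) e^{−γt} − m₂(t))/(e^{−γt} − 1)) σ₃ ), where σ₁ = [[0,1],[1,0]], σ₂ = [[0,−i],[i,0]], σ₃ = [[1,0],[0,−1]] and I₂ is the identity. -/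

import Mathlib

open Matrix
open scoped Matrix

/-- Final reconstruction formula for the qubit dephasing model: the initial density
    matrix is determined by the measurement of σ₁ at time 0 and of Q₂ = σ₂ + σ₃ at
    times 0 and t > 0. -/
theorem dephasing_reconstruction (γ t : ℝ) (hγ : 0 < γ) (ht : 0 < t)
    (ρ : Matrix (Fin 2) (Fin 2) ℂ) (hherm : ρ.IsHermitian) (htr : ρ.trace = 1)
    (D : ℝ → Matrix (Fin 2) (Fin 2) ℂ)
    (hD : ∀ s : ℝ, D s = !![1, (Real.exp (-(γ * s)) : ℂ);
                           (Real.exp (-(γ * s)) : ℂ), 1])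
    (m10 m20 m2t : ℂ)
    (hm10 : m10 = (!![0, 1; 1, 0] * (D 0 ⊙ ρ)).trace)
    (hm20 : m20 = (!![1, -Complex.I; Complex.I, -1] * (D 0 ⊙ ρ)).trace)
    (hm2t : m2t = (!![1, -Complex.I; Complex.I, -1] * (D t ⊙ ρ)).trace) :
    ρ = ((1 : ℂ) / 2) • ((1 : Matrix (Fin 2) (Fin 2) ℂ)
      + m10 • !![0, 1; 1, 0]
      + ((m2t - m20) / ((Real.exp (-(γ * t)) : ℂ) - 1)) • !![0, -Complex.I; Complex.I, 0]
      + ((m20 * (Real.exp (-(γ * t)) : ℂ) - m2t) / ((Real.exp (-(γ * t)) : ℂ) - 1))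
          • !![1, 0; 0, -1]) := by
  have hlt : Real.exp (-(γ * t)) < 1 :=
    Real.exp_lt_one_iff.mpr (neg_lt_zero.mpr (mul_pos hγ ht))
  have hne : (Real.exp (-(γ * t)) : ℂ) - 1 ≠ 0 :=
    sub_ne_zero.mpr (by exact_mod_cast hlt.ne)
  rw [hD] at hm10 hm20 hm2t
  generalize (Real.exp (-(γ * t)) : ℂ) = e at *
  simp only [mul_zero, neg_zero, Real.exp_zero, Complex.ofReal_one, trace_fin_two, mul_apply,
    Fin.sum_univ_two, hadamard_apply, of_apply, cons_val', cons_val_zero, cons_val_one,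
    cons_val_fin_one, one_mul, zero_mul, zero_add, add_zero] at hm10 hm20 hm2t htr
  have hy : (m2t - m20) / (e - 1) = Complex.I * (ρ 0 1 - ρ 1 0) := by
    rw [div_eq_iff hne, hm2t, hm20]
    ring
  have hz : (m20 * e - m2t) / (e - 1) = ρ 0 0 - ρ 1 1 := by
    rw [div_eq_iff hne, hm2t, hm20]
    ring
  rw [hy, hz, hm10]
  ext i j
  fin_cases i <;> fin_cases j <;> simp
  · linear_combination (1 / 2 : ℂ) * htr
  · linear_combination (1 / 2 : ℂ) * (ρ 0 1 - ρ 1 0) * Complex.I_sq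
  · linear_combination (-1 / 2 : ℂ) * (ρ 0 1 - ρ 1 0) * Complex.I_sq
  · linear_combination (1 / 2 : ℂ) * htr
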